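/- arXiv:2505.09492 — 2 statements merged into one kernel-verified Lean document; each statement's English description precedes it below -/
import Mathlib

section
/- Noether conservation of linear momentum for the space translation symmetry: let V : ℝ³ → ℝ be differentiable and invariant under translations in the direction a ∈ ℝ³, i.e. V(x + s•a) = V(x) for all x ∈ ℝ³ and s ∈ ℝ. Let φ, φ' : ℝ → ℝ³ satisfy Newton's equation: for every t, φ has derivative φ'(t) at t and φ' has derivative −grad V(φ(t)) at t. Then the component of linear momentum along a is conserved: for all s, t ∈ ℝ, ⟪a, φ'(s)⟫ = ⟪a, φ'(t)⟫. -/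
open RealInnerProductSpace

/-- The gradient of a function that is invariant under translations in the direction `a`
is orthogonal to `a`. -/
theorem inner_gradient_eq_zero_of_translation_invariant {E : Type*} [NormedAddCommGroup E]
    [InnerProductSpace ℝ E] [CompleteSpace E] {f : E → ℝ} {a x : E}
    (hf : DifferentiableAt ℝ f x) (hinv : ∀ s : ℝ, f (x + s • a) = f x) :
    ⟪a, gradient f x⟫ = 0 := by
  have hline : HasLineDerivAt ℝ f (fderiv ℝ f x a) x a := hf.hasFDerivAt.hasLineDerivAt a
  have hconst : HasLineDerivAt ℝ f 0 x a := by
    simpa only [HasLineDerivAt, hinv] using hasDerivAt_const (0 : ℝ) (f x)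
  rw [real_inner_comm, gradient, InnerProductSpace.toDual_symm_apply]
  exact hline.unique hconst

/-- Noether conservation of linear momentum: if the potential `V` is invariant
under translations in the direction `a`, then along any solution of Newton's
equation `φ'' = −∇V(φ)` the component `⟪a, φ'⟫` of linear momentum is conserved. -/
theorem stmt_7 (V : EuclideanSpace ℝ (Fin 3) → ℝ) (hV : Differentiable ℝ V)
    (a : EuclideanSpace ℝ (Fin 3))
    (hinv : ∀ (x : EuclideanSpace ℝ (Fin 3)) (s : ℝ), V (x + s • a) = V x)
    (φ φ' : ℝ → EuclideanSpace ℝ (Fin 3))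
    (hφ : ∀ t, HasDerivAt φ (φ' t) t)
    (hφ' : ∀ t, HasDerivAt φ' (-(gradient V (φ t))) t) :
    ∀ s t : ℝ, ⟪a, φ' s⟫ = ⟪a, φ' t⟫ := by
  have hderiv (t : ℝ) : HasDerivAt (fun t => ⟪a, φ' t⟫) 0 t := by
    have h := (hasDerivAt_const t a).inner ℝ (hφ' t)
    simpa [inner_neg_right,
      inner_gradient_eq_zero_of_translation_invariant (hV (φ t)) (hinv (φ t))] using h
  exact is_const_of_deriv_eq_zero (fun t => (hderiv t).differentiableAt)
    (fun t => (hderiv t).deriv)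
end

section
/- Noether's first theorem for one-dimensional Lagrangian mechanics with a linear symmetry: let L : ℝⁿ × ℝⁿ → ℝ be twice continuously differentiable, and let ξ : ℝⁿ → ℝⁿ be a linear map that is an infinitesimal symmetry of L, i.e. the Fréchet derivative of L at every point (q,v) evaluated on the tangent vector (ξ q, ξ v) is zero. Let φ : ℝ → ℝⁿ be a twice continuously differentiable path satisfying the Euler–Lagrange equations: for every t ∈ ℝ and every w ∈ ℝⁿ, the function s ↦ D L(φ(s), deriv φ s)(0, w) has derivative D L(φ(t), deriv φ t)(w, 0) at t. Then the Noether current t ↦ D L(φ(t), deriv φ t)(0, ξ(φ(t))) is constant on ℝ. -/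
/-- Noether's first theorem for one-dimensional Lagrangian mechanics with a linear
symmetry: if the linear map `ξ` is an infinitesimal symmetry of the `C²` Lagrangian
`L` and the `C²` path `φ` satisfies the Euler–Lagrange equations, then the Noether
current `t ↦ DL(φ(t), φ'(t))(0, ξ(φ(t)))` is constant. -/
theorem stmt_12 (n : ℕ) (L : (Fin n → ℝ) × (Fin n → ℝ) → ℝ) (hL : ContDiff ℝ 2 L)
    (ξ : (Fin n → ℝ) →ₗ[ℝ] (Fin n → ℝ))
    (hsym : ∀ q v : Fin n → ℝ, fderiv ℝ L (q, v) (ξ q, ξ v) = 0)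
    (φ : ℝ → (Fin n → ℝ)) (hφ : ContDiff ℝ 2 φ)
    (hEL : ∀ (t : ℝ) (w : Fin n → ℝ),
      HasDerivAt (fun s => fderiv ℝ L (φ s, deriv φ s) (0, w))
        (fderiv ℝ L (φ t, deriv φ t) (w, 0)) t) :
    ∀ s t : ℝ,
      fderiv ℝ L (φ s, deriv φ s) (0, ξ (φ s)) =
        fderiv ℝ L (φ t, deriv φ t) (0, ξ (φ t)) := by
  have hA : Differentiable ℝ (fun s => fderiv ℝ L (φ s, deriv φ s)) :=
    ((hL.fderiv_right (m := 1) (by norm_num)).differentiable one_ne_zero).comp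
      ((hφ.differentiable two_ne_zero).prodMk hφ.differentiable_deriv_two)
  have hcurrent (t : ℝ) :
      HasDerivAt (fun s => fderiv ℝ L (φ s, deriv φ s) (0, ξ (φ s))) 0 t := by
    have hξ : HasDerivAt (fun s => ξ (φ s)) (ξ (deriv φ t)) t :=
      ξ.toContinuousLinearMap.hasFDerivAt.comp_hasDerivAt t
        (hφ.differentiable two_ne_zero t).hasDerivAt
    have hmomentum := (hA t).hasDerivAt.clm_apply
      (hasDerivAt_const t ((0 : Fin n → ℝ), ξ (φ t)))
    have hcurr := (hA t).hasDerivAt.clm_apply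
      ((hasDerivAt_const t (0 : Fin n → ℝ)).prodMk hξ)
    have hEL_t := hmomentum.unique (hEL t (ξ (φ t)))
    rw [map_zero, add_zero] at hEL_t
    rwa [hEL_t, ← map_add, Prod.mk_add_mk, add_zero, zero_add, hsym] at hcurr
  exact is_const_of_deriv_eq_zero (fun t => (hcurrent t).differentiableAt)
    (fun t => (hcurrent t).deriv)
end
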